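/- arXiv:1607.00054 — 2 statements merged into one kernel-verified Lean document; each statement's English description precedes it below -/
import Mathlib

section
/- Let Ĝ be a group, z a central element of Ĝ, and < a left order on Ĝ such that 1 < z and z is cofinal for <. Then: (a) every coset of the central subgroup ⟨z⟩ in Ĝ contains a unique representative ĝ with 1 ≤ ĝ < z; and (b) the function c on (Ĝ/⟨z⟩)³ defined by c(x₁,x₂,x₃) := c_<(ĝ₁,ĝ₂,ĝ₃), where ĝᵢ is the unique representative of the coset xᵢ with 1 ≤ ĝᵢ < z, is a circular order on the quotient group Ĝ/⟨z⟩. -/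
noncomputable section

variable {G : Type*} [Group G]

/-- A left-invariant (strict) total order on a group `G`. -/
def IsLeftOrder (r : G → G → Prop) : Prop :=
  (∀ a, ¬ r a a) ∧ (∀ a b c, r a b → r b c → r a c) ∧
  (∀ a b, a ≠ b → r a b ∨ r b a) ∧ (∀ g a b, r a b → r (g * a) (g * b))

/-- `r` is an isolated point of the space `LO(G)` of left orders on `G` (topologized as a
subspace of `{0,1}^{G×G}` via characteristic functions): some basic neighborhood, determined
by agreement on a finite subset of `G`, contains only `r`. -/
def IsIsolatedLO (r : G → G → Prop) : Prop :=
  ∃ S : Finset G, ∀ r' : G → G → Prop, IsLeftOrder r' →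
    (∀ a ∈ S, ∀ b ∈ S, (r' a b ↔ r a b)) → r' = r

end
noncomputable section

open Classical in
/-- The circular order `c_<` determined by a linear order `r`: the sign of the permutation
sorting a triple of pairwise distinct elements, and `0` on degenerate triples. -/
noncomputable def cOfRel {α : Type*} (r : α → α → Prop) (h₁ h₂ h₃ : α) : ℤ :=
  if h₁ = h₂ ∨ h₂ = h₃ ∨ h₁ = h₃ then 0
  else if (r h₁ h₂ ∧ r h₂ h₃) ∨ (r h₂ h₃ ∧ r h₃ h₁) ∨ (r h₃ h₁ ∧ r h₁ h₂) then 1 else -1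

/-- A (left-invariant) circular order on a group. -/
def IsCircularOrder {G : Type*} [Group G] (c : G → G → G → ℤ) : Prop :=
  (∀ a b d, c a b d = 0 ↔ a = b ∨ b = d ∨ a = d) ∧
  (∀ a b d, c a b d = 1 ∨ c a b d = 0 ∨ c a b d = -1) ∧
  (∀ g₁ g₂ g₃ g₄, c g₂ g₃ g₄ - c g₁ g₃ g₄ + c g₁ g₂ g₄ - c g₁ g₂ g₃ = 0) ∧
  (∀ g u v w, c (g * u) (g * v) (g * w) = c u v w)

open Classical in
/-- Pair sign. -/
noncomputable def sgnRel {α : Type*} (r : α → α → Prop) (a b : α) : ℤ :=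
  if r a b then 1 else if r b a then -1 else 0

lemma cOfRel_eq {Γ : Type*} [Group Γ] {r : Γ → Γ → Prop} (hr : IsLeftOrder r) (a b c : Γ) :
    cOfRel r a b c = sgnRel r a b + sgnRel r b c + sgnRel r c a := by
  obtain ⟨hi, ht, htot, -⟩ := hr
  have has : ∀ x y, r x y → ¬ r y x := fun x y h h' => hi _ (ht _ _ _ h h')
  unfold cOfRel sgnRel
  by_cases hab : a = b
  · subst hab
    by_cases h1 : r a c <;> by_cases h2 : r c a <;> simp [h1, h2, hi]
    exact has _ _ h1 h2
  by_cases hbc : b = c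
  · subst hbc
    by_cases h1 : r a b <;> by_cases h2 : r b a <;> simp [h1, h2, hi]
    exact has _ _ h1 h2
  by_cases hac : a = c
  · subst hac
    by_cases h1 : r a b <;> by_cases h2 : r b a <;> simp [h1, h2, hi]
    exact has _ _ h1 h2
  have t1 := ht a b c
  have t2 := ht c b a
  rcases htot a b hab with h1 | h1 <;> rcases htot b c hbc with h2 | h2 <;>
    rcases htot a c hac with h3 | h3 <;>
    simp [hab, hbc, hac, h1, h2, h3, has _ _ h1, has _ _ h2, has _ _ h3]
  · exact has _ _ h3 (t1 h1 h2)
  · exact has _ _ h3 (t2 h2 h1)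

/-- **From left orders with cofinal central `z` to circular orders on the quotient.**
Let `z` be a central element of `Ghat` (whence `⟨z⟩` is normal, which we record as an
instance) and `<` a left order on `Ghat` with `1 < z` and `z` cofinal.  Then (a) every coset
of `⟨z⟩` has a unique representative `g0` with `1 ≤ g0 < z`, and (b) the function on
`(Ghat/⟨z⟩)³` given by applying `c_<` to these representatives is a circular order on
`Ghat/⟨z⟩`. -/
theorem central_cofinal_gives_circular_order {Ghat : Type*} [Group Ghat] (z : Ghat)
    (hz : ∀ g : Ghat, g * z = z * g) [hN : (Subgroup.zpowers z).Normal]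
    (r : Ghat → Ghat → Prop) (hr : IsLeftOrder r) (h1z : r 1 z)
    (hcof : ∀ g : Ghat, ∃ n : ℕ, r g (z ^ n)) :
    (∀ x : Ghat ⧸ Subgroup.zpowers z, ∃! g0 : Ghat,
        QuotientGroup.mk g0 = x ∧ (g0 = 1 ∨ r 1 g0) ∧ r g0 z) ∧
    ∃ c : (Ghat ⧸ Subgroup.zpowers z) → (Ghat ⧸ Subgroup.zpowers z) →
        (Ghat ⧸ Subgroup.zpowers z) → ℤ,
      IsCircularOrder c ∧
      ∀ g1 g2 g3 : Ghat,
        ((g1 = 1 ∨ r 1 g1) ∧ r g1 z) → ((g2 = 1 ∨ r 1 g2) ∧ r g2 z) →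
        ((g3 = 1 ∨ r 1 g3) ∧ r g3 z) →
        c (QuotientGroup.mk g1) (QuotientGroup.mk g2) (QuotientGroup.mk g3) =
          cOfRel r g1 g2 g3 := by
  have hr' := hr
  obtain ⟨hi, ht, htot, hl⟩ := hr'
  have has : ∀ x y, r x y → ¬ r y x := fun x y h h' => hi _ (ht _ _ _ h h')
  have hl' : ∀ g a b, r (g * a) (g * b) → r a b := by
    intro g a b h
    have := hl g⁻¹ _ _ h
    simpa using this
  have hcz : ∀ g, Commute g z := hz
  have hR : ∀ a b, r a b → r (a * z) (b * z) := by
    intro a b h; rw [hz a, hz b]; exact hl z _ _ h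
  have hpos : ∀ n : ℕ, r 1 (z ^ (n + 1)) := by
    intro n
    induction n with
    | zero => simpa using h1z
    | succ n ih =>
      have := hl (z ^ (n + 1)) _ _ h1z
      rw [mul_one, ← pow_succ] at this
      exact ht _ _ _ ih this
  have hmono : ∀ m n : ℤ, m < n → r (z ^ m) (z ^ n) := by
    intro m n h
    obtain ⟨k, hk⟩ := Int.le.dest (show m + 1 ≤ n by omega)
    have := hl (z ^ m) _ _ (hpos k)
    rw [mul_one, ← zpow_natCast, ← zpow_add] at this
    have e : n = m + ((k + 1 : ℕ) : ℤ) := by push_cast; omega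
    rw [e]; exact this
  -- existence
  have hex : ∀ g : Ghat, ∃ n : ℤ, ((z ^ n * g) = 1 ∨ r 1 (z ^ n * g)) ∧ r (z ^ n * g) z := by
    intro g
    obtain ⟨n, hn⟩ := hcof g
    obtain ⟨m, hm⟩ := hcof g⁻¹
    have hm' : r (z ^ (-(m : ℤ))) g := by
      have h := hl g _ _ hm
      rw [mul_inv_cancel] at h
      have h2 := hl (z ^ (-(m : ℤ))) _ _ h
      rw [((hcz g).pow_right m).eq] at h2
      simpa using h2
    obtain ⟨k, hk, hmin⟩ := Int.exists_least_of_bdd (P := fun k : ℤ => r g (z ^ k))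
      ⟨-(m : ℤ), fun k hk => by
        by_contra hlt
        exact has _ _ (ht _ _ _ hm' hk) (hmono _ _ (by omega))⟩ ⟨n, by simpa using hn⟩
    refine ⟨-(k - 1), ?_, ?_⟩
    · have h1 : ¬ r g (z ^ (k - 1)) := fun h => by have := hmin _ h; omega
      by_cases he : g = z ^ (k - 1)
      · left; rw [he, ← zpow_add]; simp
      · right
        have := hl (z ^ (-(k - 1))) _ _ ((htot _ _ he).resolve_left h1)
        rwa [← zpow_add, neg_add_cancel, zpow_zero] at this
    · have := hl (z ^ (-(k - 1))) _ _ hk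
      rw [← zpow_add] at this
      have e : -(k - 1) + k = 1 := by ring
      rwa [e, zpow_one] at this
  -- uniqueness
  have hle : ∀ (g : Ghat) (k : ℤ), (g = 1 ∨ r 1 g) → r (z ^ k * g) z → k ≤ 0 := by
    intro g k h1 h2
    by_contra hk
    have h3 : z ^ k = z ^ k * g ∨ r (z ^ k) (z ^ k * g) := by
      rcases h1 with h1 | h1
      · left; rw [h1, mul_one]
      · right; simpa using hl (z ^ k) _ _ h1
    have h4 : r (z ^ k) z := by
      rcases h3 with h3 | h3
      · rwa [← h3] at h2
      · exact ht _ _ _ h3 h2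
    by_cases hk1 : k = 1
    · rw [hk1, zpow_one] at h4; exact hi _ h4
    · have := hmono 1 k (by omega)
      rw [zpow_one] at this
      exact has _ _ this h4
  have huniq : ∀ a b : Ghat, (QuotientGroup.mk a : Ghat ⧸ Subgroup.zpowers z) = QuotientGroup.mk b →
      ((a = 1 ∨ r 1 a) ∧ r a z) → ((b = 1 ∨ r 1 b) ∧ r b z) → a = b := by
    intro a b hab ha hb
    rw [QuotientGroup.eq, Subgroup.mem_zpowers_iff] at hab
    obtain ⟨k, hk⟩ := hab
    have e : b = z ^ k * a := by
      rw [← ((hcz a).zpow_right k).eq, hk]; simp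
    have h1 := hle a k ha.1 (e ▸ hb.2)
    have e' : a = z ^ (-k) * b := by rw [e]; simp
    have h2 := hle b (-k) hb.1 (e' ▸ ha.2)
    have : k = 0 := by omega
    rw [e, this]; simp
  have hmk : ∀ (n : ℤ) (g : Ghat), (QuotientGroup.mk (z ^ n * g) : Ghat ⧸ Subgroup.zpowers z)
      = QuotientGroup.mk g := by
    intro n g
    rw [QuotientGroup.eq, Subgroup.mem_zpowers_iff]
    exact ⟨-n, by rw [mul_inv_rev, mul_assoc, ← zpow_neg, ← ((hcz g).zpow_right _).eq]; simp⟩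
  have hA : ∀ x : Ghat ⧸ Subgroup.zpowers z, ∃ g0 : Ghat,
        QuotientGroup.mk g0 = x ∧ (g0 = 1 ∨ r 1 g0) ∧ r g0 z := by
    intro x
    obtain ⟨g, rfl⟩ := QuotientGroup.mk_surjective x
    obtain ⟨n, hn⟩ := hex g
    exact ⟨z ^ n * g, hmk n g, hn⟩
  refine ⟨fun x => ?_, ?_⟩
  · obtain ⟨g0, h0, h1⟩ := hA x
    exact ⟨g0, ⟨h0, h1⟩, fun y hy => huniq _ _ (hy.1.trans h0.symm) hy.2 h1⟩
  choose f hf hfI using hA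
  have hfu : ∀ (x) (g : Ghat), QuotientGroup.mk g = x → ((g = 1 ∨ r 1 g) ∧ r g z) → f x = g :=
    fun x g h hg => huniq _ _ ((hf x).trans h.symm) (hfI x) hg
  have hfinj : ∀ x y, f x = f y ↔ x = y := by
    intro x y
    exact ⟨fun h => by rw [← hf x, ← hf y, h], fun h => by rw [h]⟩
  refine ⟨fun x y w => cOfRel r (f x) (f y) (f w), ⟨?_, ?_, ?_, ?_⟩, ?_⟩
  · intro a b d
    simp only [← hfinj]
    unfold cOfRel
    split_ifs with h1 h2
    · exact ⟨fun _ => h1, fun _ => rfl⟩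
    · exact ⟨fun h => absurd h (by decide), fun h => absurd h h1⟩
    · exact ⟨fun h => absurd h (by decide), fun h => absurd h h1⟩
  · intro a b d
    simp only [cOfRel]
    split_ifs <;> simp
  · intro a b c d
    have hs : ∀ x y, sgnRel r x y = - sgnRel r y x := by
      intro x y
      unfold sgnRel
      by_cases h1 : r x y <;> by_cases h2 : r y x <;> simp [h1, h2]
      exact has _ _ h1 h2
    simp only [cOfRel_eq hr]
    rw [hs (f d) (f b), hs (f c) (f a), hs (f d) (f a)]
    ring
  · intro g u v w
    classical
    -- the shift
    have key : ∀ x y, sgnRel r (f (g * x)) (f (g * y)) = sgnRel r (f x) (f y)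
        + 2 * ((if r (f g * f x) z then 0 else 1) - (if r (f g * f y) z then 0 else 1)) := by
      have hcase1 : ∀ x, r (f g * f x) z → f (g * x) = f g * f x := by
        intro x h
        apply hfu _ _ _ ⟨_, h⟩
        · rw [QuotientGroup.mk_mul, hf, hf]
        · rcases (hfI x).1 with h1 | h1
          · rw [h1, mul_one]; exact (hfI g).1
          · right
            have := hl (f g) _ _ h1
            rw [mul_one] at this
            rcases (hfI g).1 with h2 | h2
            · rwa [h2] at this ⊢
            · exact ht _ _ _ h2 this
      have hcase2 : ∀ x, ¬ r (f g * f x) z → z * f (g * x) = f g * f x := by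
        intro x h
        have : f (g * x) = z ^ (-1 : ℤ) * (f g * f x) := by
          apply hfu
          · rw [hmk, QuotientGroup.mk_mul, hf, hf]
          · have e : z ^ (-1 : ℤ) * z = 1 := by simp
            constructor
            · by_cases h1 : f g * f x = z
              · left; rw [h1, e]
              · right
                have := hl (z ^ (-1 : ℤ)) _ _ ((htot _ _ h1).resolve_left h)
                rwa [e] at this
            · have h1 := hl (f g) _ _ (hfI x).2
              have h2 := hR _ _ (hfI g).2
              have := hl (z ^ (-1 : ℤ)) _ _ (ht _ _ _ h1 h2)
              simpa using this
        rw [this]; simp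
      have hsl : ∀ a x y, sgnRel r (a * x) (a * y) = sgnRel r x y := by
        intro a x y
        have : ∀ x y, r (a * x) (a * y) ↔ r x y := fun x y => ⟨hl' a x y, hl a x y⟩
        simp only [sgnRel, this]
      have hlt : ∀ x y, r x y → sgnRel r x y = 1 ∧ sgnRel r y x = -1 := by
        intro x y h
        simp [sgnRel, h, has _ _ h]
      -- unshifted vs shifted
      have hmix : ∀ x y, r (f g * f x) z → ¬ r (f g * f y) z →
          r (f x) (f y) ∧ r (f (g * y)) (f (g * x)) := by
        intro x y hx hy
        constructor
        · apply hl' (f g)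
          by_cases h1 : f g * f y = z
          · rwa [h1]
          · exact ht _ _ _ hx ((htot _ _ h1).resolve_left hy)
        · apply hl' z
          rw [hcase2 y hy, hcase1 x hx]
          have h1 := hl (f g) _ _ (hfI y).2
          rw [hz] at h1
          rcases (hfI x).1 with h2 | h2
          · rwa [h2, mul_one]
          · have h3 := hl z _ _ (hl (f g) _ _ h2)
            rw [mul_one] at h3
            exact ht _ _ _ h1 h3
      intro x y
      by_cases hx : r (f g * f x) z <;> by_cases hy : r (f g * f y) z
      · rw [hcase1 x hx, hcase1 y hy, hsl]; simp [hx, hy]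
      · obtain ⟨h1, h2⟩ := hmix x y hx hy
        rw [(hlt _ _ h1).1, (hlt _ _ h2).2]; simp [hx, hy]
      · obtain ⟨h1, h2⟩ := hmix y x hy hx
        rw [(hlt _ _ h1).2, (hlt _ _ h2).1]; simp [hx, hy]
      · rw [← hsl z, hcase2 x hx, hcase2 y hy, hsl]; simp [hx, hy]
    simp only [cOfRel_eq hr, key]
    ring
  · intro g1 g2 g3 h1 h2 h3
    simp only [hfu _ g1 rfl h1, hfu _ g2 rfl h2, hfu _ g3 rfl h3]

end
end

section
/- Let Ĝ be a finitely generated group, z a central element of Ĝ, and < a left order on Ĝ with 1 < z and z cofinal for <. Let c be the induced circular order on G = Ĝ/⟨z⟩ defined by c(x₁,x₂,x₃) := c_<(ĝ₁,ĝ₂,ĝ₃), where ĝᵢ is the unique representative of the coset xᵢ with 1 ≤ ĝᵢ < z. If c is isolated in CO(G), then < is isolated in LO(Ĝ). -/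
noncomputable section

/-- `c` is an isolated point of the space `CO(G)` of circular orders on `G`. -/
def IsIsolatedCO {G : Type*} [Group G] (c : G → G → G → ℤ) : Prop :=
  ∃ S : Finset G, ∀ c' : G → G → G → ℤ, IsCircularOrder c' →
    (∀ u ∈ S, ∀ v ∈ S, ∀ w ∈ S, c' u v w = c u v w) → c' = c

section helpers
variable {H : Type*} [Group H] {z : H} {r : H → H → Prop}

lemma aux_zpow_lt (hr : IsLeftOrder r) (h1 : r 1 z) {m n : ℤ} (h : m < n) :
    r (z ^ m) (z ^ n) := by
  obtain ⟨hi, ht, hl, hm⟩ := hr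
  have key : ∀ k : ℕ, r 1 (z ^ (k + 1)) := by
    intro k
    induction k with
    | zero => simpa using h1
    | succ k ih =>
      have := hm (z ^ (k + 1)) _ _ h1
      rw [mul_one, ← pow_succ] at this
      exact ht _ _ _ ih this
  obtain ⟨k, rfl⟩ : ∃ k : ℕ, n = m + (k + 1) := ⟨(n - m - 1).toNat, by omega⟩
  have := hm (z ^ m) _ _ (key k)
  rw [mul_one] at this
  rw [zpow_add]
  exact_mod_cast this

lemma aux_comm (hz : ∀ g : H, g * z = z * g) (g : H) (n : ℤ) : g * z ^ n = z ^ n * g :=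
  (Commute.zpow_right (hz g) n)

lemma aux_mul_right (hr : IsLeftOrder r) (hz : ∀ g : H, g * z = z * g) {a b : H} (n : ℤ)
    (h : r a b) : r (a * z ^ n) (b * z ^ n) := by
  rw [aux_comm hz, aux_comm hz]
  exact hr.2.2.2 _ _ _ h

lemma aux_inj (hr : IsLeftOrder r) (h1 : r 1 z) {m n : ℤ} (h : z ^ m = z ^ n) : m = n := by
  rcases lt_trichotomy m n with h' | h' | h'
  · have := aux_zpow_lt hr h1 h'
    rw [h] at this
    exact absurd this (hr.1 _)
  · exact h'
  · have := aux_zpow_lt hr h1 h'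
    rw [h] at this
    exact absurd this (hr.1 _)

/-- The relation between the order and the (doubled) symmetrised floor function. -/
def PsiSpec (z : H) (r : H → H → Prop) (ψ : H → ℤ) : Prop :=
  ∀ x m, (ψ x = 2 * m ↔ x = z ^ m) ∧ (ψ x = 2 * m + 1 ↔ r (z ^ m) x ∧ r x (z ^ (m + 1)))

lemma aux_exists_psi (hr : IsLeftOrder r) (h1 : r 1 z)
    (hb : ∀ g, ∃ m n : ℤ, r (z ^ m) g ∧ r g (z ^ n)) : ∃ ψ, PsiSpec z r ψ := by
  have lt_of : ∀ {m n : ℤ}, r (z ^ m) (z ^ n) → m < n := by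
    intro m n h
    by_contra hc
    rcases (not_lt.1 hc).lt_or_eq with h' | h'
    · exact hr.1 _ (hr.2.1 _ _ _ h (aux_zpow_lt hr h1 h'))
    · subst h'
      exact hr.1 _ h
  have ex : ∀ x, ∃ k : ℤ, ∀ m, (k = 2 * m ↔ x = z ^ m) ∧
      (k = 2 * m + 1 ↔ r (z ^ m) x ∧ r x (z ^ (m + 1))) := by
    intro x
    by_cases hx : ∃ m : ℤ, x = z ^ m
    · obtain ⟨m, rfl⟩ := hx
      refine ⟨2 * m, fun n => ⟨⟨fun h => by rw [show m = n by omega],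
        fun h => by rw [aux_inj hr h1 h]⟩, ⟨fun h => by omega, fun h => ?_⟩⟩⟩
      have := lt_of h.1
      have := lt_of h.2
      omega
    · push Not at hx
      obtain ⟨a, b, ha, hb⟩ := hb x
      obtain ⟨m, hm, hmax⟩ := Int.exists_greatest_of_bdd (P := fun m => r (z ^ m) x)
        ⟨b, fun k hk => (lt_of (hr.2.1 _ _ _ hk hb)).le⟩ ⟨a, ha⟩
      have hm' : r x (z ^ (m + 1)) := by
        rcases hr.2.2.1 _ _ (hx (m + 1)) with h | h
        · exact h
        · have := hmax _ h
          omega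
      refine ⟨2 * m + 1, fun n => ⟨⟨fun h => by omega, fun h => absurd h (hx n)⟩,
        ⟨fun h => ?_, fun h => ?_⟩⟩⟩
      · obtain rfl : m = n := by omega
        exact ⟨hm, hm'⟩
      · have := lt_of (hr.2.1 _ _ _ hm h.2)
        have := lt_of (hr.2.1 _ _ _ h.1 hm')
        omega
  choose ψ hψ using ex
  exact ⟨ψ, hψ⟩

variable {ψ : H → ℤ}

lemma psi_zpow (hs : PsiSpec z r ψ) (m : ℤ) : ψ (z ^ m) = 2 * m := (hs _ m).1.2 rfl

lemma psi_inv (hr : IsLeftOrder r) (hz : ∀ g : H, g * z = z * g) (hs : PsiSpec z r ψ) (x : H) :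
    ψ x⁻¹ = - ψ x := by
  rcases Int.even_or_odd' (ψ x) with ⟨m, h | h⟩
  · rw [h, (hs x m).1.1 h, ← zpow_neg, psi_zpow hs]; ring
  · rw [h, show -(2 * m + 1) = 2 * (-m - 1) + 1 by ring, (hs _ _).2]
    obtain ⟨h1, h2⟩ := (hs x m).2.1 h
    constructor
    · have := hr.2.2.2 (x⁻¹ * z ^ (-m - 1)) _ _ h2
      rw [mul_assoc, mul_assoc, ← zpow_add, ← aux_comm hz x, inv_mul_cancel_left] at this
      simpa using this
    · have := hr.2.2.2 (x⁻¹ * z ^ (-m)) _ _ h1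
      rw [mul_assoc, mul_assoc, ← zpow_add, ← aux_comm hz x, inv_mul_cancel_left] at this
      simpa using this

lemma psi_mul_zpow (hr : IsLeftOrder r) (hz : ∀ g : H, g * z = z * g) (hs : PsiSpec z r ψ)
    (x : H) (k : ℤ) : ψ (x * z ^ k) = ψ x + 2 * k := by
  rcases Int.even_or_odd' (ψ x) with ⟨m, h | h⟩
  · rw [h, (hs x m).1.1 h, ← zpow_add, psi_zpow hs]; ring
  · rw [h, show 2 * m + 1 + 2 * k = 2 * (m + k) + 1 by ring, (hs _ _).2]
    obtain ⟨h1, h2⟩ := (hs x m).2.1 h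
    have h1 := aux_mul_right hr hz k h1
    have h2 := aux_mul_right hr hz k h2
    rw [← zpow_add] at h1 h2
    exact ⟨h1, by rwa [show m + k + 1 = m + 1 + k by ring]⟩

lemma psi_mul (hr : IsLeftOrder r) (hz : ∀ g : H, g * z = z * g)
    (hs : PsiSpec z r ψ) (x y : H) :
    (ψ x + ψ y - ψ (x * y) = 0 ∧ (Even (ψ x) ∨ Even (ψ y) ∨ Even (ψ (x * y)))) ∨
    ((ψ x + ψ y - ψ (x * y) = 1 ∨ ψ x + ψ y - ψ (x * y) = -1) ∧
      ¬ (Even (ψ x) ∨ Even (ψ y) ∨ Even (ψ (x * y)))) := by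
  rcases Int.even_or_odd' (ψ x) with ⟨m, h | h⟩
  · left
    refine ⟨?_, Or.inl (by simp [h])⟩
    rw [h, (hs x m).1.1 h, ← aux_comm hz, psi_mul_zpow hr hz hs]; ring
  rcases Int.even_or_odd' (ψ y) with ⟨n, h' | h'⟩
  · left
    refine ⟨?_, Or.inr (Or.inl (by simp [h']))⟩
    rw [h', (hs y n).1.1 h', psi_mul_zpow hr hz hs]; ring
  obtain ⟨a1, a2⟩ := (hs x m).2.1 h
  obtain ⟨b1, b2⟩ := (hs y n).2.1 h'
  have l1 : r (z ^ (m + n)) (x * y) := by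
    have e1 := aux_mul_right hr hz n a1
    rw [← zpow_add] at e1
    exact hr.2.1 _ _ _ e1 (hr.2.2.2 x _ _ b1)
  have l2 : r (x * y) (z ^ (m + n + 1 + 1)) := by
    have e1 := aux_mul_right hr hz (n + 1) a2
    rw [← zpow_add] at e1
    rw [show m + n + 1 + 1 = m + 1 + (n + 1) by ring]
    exact hr.2.1 _ _ _ (hr.2.2.2 x _ _ b2) e1
  by_cases e : x * y = z ^ (m + n + 1)
  · left
    have := (hs _ _).1.2 e
    exact ⟨by omega, Or.inr (Or.inr (by rw [this]; simp))⟩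
  · right
    rcases hr.2.2.1 _ _ e with e | e
    · have := (hs (x * y) (m + n)).2.2 ⟨l1, e⟩
      rw [h, h', this]
      refine ⟨Or.inl (by ring), ?_⟩
      simp only [Int.even_iff]
      omega
    · have := (hs (x * y) (m + n + 1)).2.2 ⟨e, l2⟩
      rw [h, h', this]
      refine ⟨Or.inr (by ring), ?_⟩
      simp only [Int.even_iff]
      omega

/-- The homogeneous cocycle of `ψ`. -/
def psiC (ψ : H → ℤ) (a b d : H) : ℤ := ψ (a⁻¹ * b) + ψ (b⁻¹ * d) - ψ (a⁻¹ * d)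

lemma psi_even_iff (hs : PsiSpec z r ψ) (a b : H) :
    Even (ψ (a⁻¹ * b)) ↔
      (QuotientGroup.mk a : H ⧸ Subgroup.zpowers z) = QuotientGroup.mk b := by
  rw [QuotientGroup.eq, Subgroup.mem_zpowers_iff]
  constructor
  · rintro ⟨k, hk⟩
    exact ⟨k, ((hs _ k).1.1 (by omega)).symm⟩
  · rintro ⟨k, hk⟩
    rw [← hk, psi_zpow hs]
    simp

lemma psiC_congr (hr : IsLeftOrder r) (hz : ∀ g : H, g * z = z * g) (hs : PsiSpec z r ψ)
    {a b d a' b' d' : H}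
    (ha : (QuotientGroup.mk a : H ⧸ Subgroup.zpowers z) = QuotientGroup.mk a')
    (hb : (QuotientGroup.mk b : H ⧸ Subgroup.zpowers z) = QuotientGroup.mk b')
    (hd : (QuotientGroup.mk d : H ⧸ Subgroup.zpowers z) = QuotientGroup.mk d') :
    psiC ψ a b d = psiC ψ a' b' d' := by
  rw [QuotientGroup.eq, Subgroup.mem_zpowers_iff] at ha hb hd
  obtain ⟨i, hi⟩ := ha
  obtain ⟨j, hj⟩ := hb
  obtain ⟨k, hk⟩ := hd
  obtain rfl : a' = a * z ^ i := by rw [hi]; group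
  obtain rfl : b' = b * z ^ j := by rw [hj]; group
  obtain rfl : d' = d * z ^ k := by rw [hk]; group
  have key : ∀ (p q : H) (s t : ℤ),
      ψ ((p * z ^ s)⁻¹ * (q * z ^ t)) = ψ (p⁻¹ * q) + 2 * (t - s) := by
    intro p q s t
    rw [← psi_mul_zpow hr hz hs]
    congr 1
    rw [mul_inv_rev, ← zpow_neg, ← aux_comm hz, mul_assoc, ← mul_assoc _ q, ← aux_comm hz,
      mul_assoc, ← zpow_add, ← mul_assoc]
    congr 2
    ring
  unfold psiC
  rw [key, key, key]
  ring

/-- The induced function on the quotient. -/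
def quotC (z : H) (ψ : H → ℤ) (u v w : H ⧸ Subgroup.zpowers z) : ℤ :=
  psiC ψ u.out v.out w.out

lemma quotC_mk (hr : IsLeftOrder r) (hz : ∀ g : H, g * z = z * g) (hs : PsiSpec z r ψ)
    (a b d : H) : quotC z ψ (QuotientGroup.mk a) (QuotientGroup.mk b) (QuotientGroup.mk d)
      = psiC ψ a b d := by
  apply psiC_congr hr hz hs <;> exact QuotientGroup.out_eq' _

lemma quotC_circ [(Subgroup.zpowers z).Normal] (hr : IsLeftOrder r)
    (hz : ∀ g : H, g * z = z * g)
    (hs : PsiSpec z r ψ) : IsCircularOrder (quotC z ψ) := by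
  have main : ∀ a b d : H, _ := fun a b d => psi_mul hr hz hs (a⁻¹ * b) (b⁻¹ * d)
  have e : ∀ a b d : H, a⁻¹ * b * (b⁻¹ * d) = a⁻¹ * d := by intros; group
  simp only [e, psi_even_iff hs] at main
  refine ⟨?_, ?_, ?_, ?_⟩
  · intro a b d
    induction a using QuotientGroup.induction_on with | _ a
    induction b using QuotientGroup.induction_on with | _ b
    induction d using QuotientGroup.induction_on with | _ d
    rw [quotC_mk hr hz hs]
    have := main a b d
    unfold psiC
    constructor
    · intro h
      rcases this with h' | h'
      · exact h'.2
      · omega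
    · intro h
      rcases this with h' | h'
      · exact h'.1
      · exact absurd h h'.2
  · intro a b d
    induction a using QuotientGroup.induction_on with | _ a
    induction b using QuotientGroup.induction_on with | _ b
    induction d using QuotientGroup.induction_on with | _ d
    rw [quotC_mk hr hz hs]
    have := main a b d
    unfold psiC
    omega
  · intro a b d f
    simp only [quotC, psiC]
    ring
  · intro g a b d
    induction a using QuotientGroup.induction_on with | _ a
    induction b using QuotientGroup.induction_on with | _ b
    induction d using QuotientGroup.induction_on with | _ d
    induction g using QuotientGroup.induction_on with | _ g
    simp only [← QuotientGroup.mk_mul]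
    rw [quotC_mk hr hz hs, quotC_mk hr hz hs]
    have : ∀ p q : H, (g * p)⁻¹ * (g * q) = p⁻¹ * q := by intros; group
    simp only [psiC, this]

open Classical in
lemma psi_sgn (hr : IsLeftOrder r) (hz : ∀ g : H, g * z = z * g) (hs : PsiSpec z r ψ)
    {a b : H} (ha : (a = 1 ∨ r 1 a) ∧ r a z) (hb : (b = 1 ∨ r 1 b) ∧ r b z) :
    ψ (a⁻¹ * b) = if a = b then 0 else if r a b then 1 else -1 := by
  have key : ∀ a b : H, (a = 1 ∨ r 1 a) → r b z → r a b → ψ (a⁻¹ * b) = 1 := by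
    intro a b ha hb hab
    have := (hs (a⁻¹ * b) 0).2.2 ⟨?_, ?_⟩
    · simpa using this
    · have := hr.2.2.2 a⁻¹ _ _ hab
      simpa using this
    · have haz : r b (a * z) := by
        rcases ha with rfl | ha
        · simpa using hb
        · have := aux_mul_right hr hz 1 ha
          simp only [zpow_one, one_mul] at this
          exact hr.2.1 _ _ _ hb this
      have := hr.2.2.2 a⁻¹ _ _ haz
      simpa using this
  split_ifs with h1 h2
  · subst h1
    have := psi_zpow hs 0
    simpa using this
  · exact key _ _ ha.1 hb.2 h2
  · have := key b a hb.1 ha.2 ((hr.2.2.1 _ _ h1).resolve_left h2)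
    have e : (a⁻¹ * b) = (b⁻¹ * a)⁻¹ := by group
    rw [e, psi_inv hr hz hs, this]

lemma psiC_eq (hr : IsLeftOrder r) (hz : ∀ g : H, g * z = z * g) (hs : PsiSpec z r ψ)
    {a b d : H} (ha : (a = 1 ∨ r 1 a) ∧ r a z) (hb : (b = 1 ∨ r 1 b) ∧ r b z)
    (hd : (d = 1 ∨ r 1 d) ∧ r d z) : psiC ψ a b d = cOfRel r a b d := by
  unfold psiC cOfRel
  rw [psi_sgn hr hz hs ha hb, psi_sgn hr hz hs hb hd, psi_sgn hr hz hs ha hd]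
  obtain ⟨hi, ht, hl, hm⟩ := hr
  have t1 := ht a b d
  have t2 := ht a d b
  have t3 := ht b a d
  have t4 := ht b d a
  have t5 := ht d a b
  have t6 := ht d b a
  have i1 := ht a b a
  have i2 := ht a d a
  have i3 := ht b d b
  have := hi a
  have := hi b
  have := hi d
  have := hl a b
  have := hl a d
  have := hl b d
  grind

lemma psi_pos (hr : IsLeftOrder r) (h1 : r 1 z) (hs : PsiSpec z r ψ) (x : H) :
    r 1 x ↔ 0 < ψ x := by
  have z0 : z ^ (0 : ℤ) = 1 := zpow_zero z
  have asym : ∀ a b, r a b → ¬ r b a := fun a b h h' => hr.1 _ (hr.2.1 _ _ _ h h')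
  rcases Int.even_or_odd' (ψ x) with ⟨m, h | h⟩
  · rw [h, (hs x m).1.1 h]
    constructor
    · intro h'
      by_contra hc
      rcases (show m < 0 ∨ m = 0 by omega) with h2 | h2
      · have := aux_zpow_lt hr h1 h2
        rw [z0] at this
        exact asym _ _ h' this
      · subst h2
        rw [z0] at h'
        exact hr.1 _ h'
    · intro h'
      have := aux_zpow_lt hr h1 (show 0 < m by omega)
      rwa [z0] at this
  · rw [h]
    obtain ⟨a1, a2⟩ := (hs x m).2.1 h
    constructor
    · intro h'
      by_contra hc
      have h2 := hr.2.1 _ _ _ h' a2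
      rcases (show m + 1 < 0 ∨ m + 1 = 0 by omega) with h3 | h3
      · have := aux_zpow_lt hr h1 h3
        rw [z0] at this
        exact asym _ _ h2 this
      · rw [h3, z0] at h2
        exact hr.1 _ h2
    · intro h'
      rcases (show 0 < m ∨ m = 0 by omega) with h3 | h3
      · have := aux_zpow_lt hr h1 h3
        rw [z0] at this
        exact hr.2.1 _ _ _ this a1
      · rwa [h3, z0] at a1

lemma order_ext {r' : H → H → Prop} (hr : IsLeftOrder r) (hr' : IsLeftOrder r')
    (h : ∀ x, r' 1 x ↔ r 1 x) : r' = r := by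
  have key : ∀ {s : H → H → Prop}, IsLeftOrder s → ∀ a b, s a b ↔ s 1 (a⁻¹ * b) := by
    intro s hs a b
    constructor
    · intro h
      simpa using hs.2.2.2 a⁻¹ _ _ h
    · intro h
      simpa using hs.2.2.2 a _ _ h
  funext a b
  rw [key hr, key hr', h]

lemma exists_rep (hr : IsLeftOrder r) (hz : ∀ g : H, g * z = z * g) (h1 : r 1 z)
    (hs : PsiSpec z r ψ)
    (u : H ⧸ Subgroup.zpowers z) : ∃ a : H, QuotientGroup.mk a = u ∧
      ((a = 1 ∨ r 1 a) ∧ r a z) := by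
  induction u using QuotientGroup.induction_on with | _ x
  rcases Int.even_or_odd' (ψ x) with ⟨m, h | h⟩
  · refine ⟨1, ?_, Or.inl rfl, h1⟩
    rw [QuotientGroup.eq, Subgroup.mem_zpowers_iff]
    exact ⟨m, by simpa using ((hs x m).1.1 h).symm⟩
  · have e : ψ (x * z ^ (-m)) = 2 * 0 + 1 := by
      rw [psi_mul_zpow hr hz hs, h]; ring
    obtain ⟨a1, a2⟩ := (hs _ _).2.1 e
    refine ⟨x * z ^ (-m), ?_, ?_⟩
    · rw [QuotientGroup.eq, Subgroup.mem_zpowers_iff]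
      exact ⟨m, by simp⟩
    · exact ⟨Or.inr (by simpa using a1), by simpa using a2⟩

lemma bounds_of_gen (hr : IsLeftOrder r) (hz : ∀ g : H, g * z = z * g) (h1 : r 1 z)
    {T : Set H} (hT : Subgroup.closure T = ⊤)
    (hb : ∀ g ∈ T, ∃ m n : ℤ, r (z ^ m) g ∧ r g (z ^ n)) (g : H) :
    ∃ m n : ℤ, r (z ^ m) g ∧ r g (z ^ n) := by
  have hg : g ∈ Subgroup.closure T := by rw [hT]; trivial
  induction hg using Subgroup.closure_induction with
  | mem x hx => exact hb x hx
  | one =>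
    have a1 := aux_zpow_lt hr h1 (show (-1 : ℤ) < 0 by omega)
    have a2 := aux_zpow_lt hr h1 (show (0 : ℤ) < 1 by omega)
    rw [zpow_zero] at a1 a2
    exact ⟨_, _, a1, a2⟩
  | mul x y _ _ hx hy =>
    obtain ⟨m, n, a1, a2⟩ := hx
    obtain ⟨m', n', b1, b2⟩ := hy
    refine ⟨m + m', n + n', ?_, ?_⟩
    · rw [zpow_add]
      exact hr.2.1 _ _ _ (aux_mul_right hr hz m' a1) (hr.2.2.2 x _ _ b1)
    · rw [zpow_add]
      exact hr.2.1 _ _ _ (hr.2.2.2 x _ _ b2) (aux_mul_right hr hz n' a2)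
  | inv x _ hx =>
    obtain ⟨m, n, a1, a2⟩ := hx
    refine ⟨-n, -m, ?_, ?_⟩
    · have := hr.2.2.2 (x⁻¹ * z ^ (-n)) _ _ a2
      rw [mul_assoc, mul_assoc, ← zpow_add, ← aux_comm hz x, inv_mul_cancel_left] at this
      simpa using this
    · have := hr.2.2.2 (x⁻¹ * z ^ (-m)) _ _ a1
      rw [mul_assoc, mul_assoc, ← zpow_add, ← aux_comm hz x, inv_mul_cancel_left] at this
      simpa using this

lemma psi_unique {r' : H → H → Prop} {ψ' : H → ℤ}
    (hr : IsLeftOrder r) (hr' : IsLeftOrder r') (hz : ∀ g : H, g * z = z * g)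
    (hs : PsiSpec z r ψ) (hs' : PsiSpec z r' ψ')
    {T : Set H} (hT : Subgroup.closure T = ⊤) (hg : ∀ g ∈ T, ψ' g = ψ g)
    (hc : quotC z ψ' = quotC z ψ) (g : H) : ψ' g = ψ g := by
  have hg' : g ∈ Subgroup.closure T := by rw [hT]; trivial
  induction hg' using Subgroup.closure_induction with
  | mem x hx => exact hg x hx
  | one =>
    have a := psi_zpow hs 0
    have b := psi_zpow hs' 0
    rw [zpow_zero] at a b
    rw [a, b]
  | mul x y _ _ hx hy =>
    have a := quotC_mk hr hz hs 1 x (x * y)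
    have b := quotC_mk hr' hz hs' 1 x (x * y)
    rw [hc, a] at b
    simp only [psiC, inv_one, one_mul, inv_mul_cancel_left] at b
    omega
  | inv x _ hx => rw [psi_inv hr hz hs, psi_inv hr' hz hs', hx]

end helpers

/-- **Isolated circular orders on the quotient give isolated left orders.**
Let `Ghat` be a finitely generated group, `z` a central element (so `⟨z⟩` is normal, which
we record as an instance), and `<` a left order on `Ghat` with `1 < z` and `z` cofinal.
Let `c` be the induced circular order on `G = Ghat/⟨z⟩`, defined via the unique coset
representatives `g0` with `1 ≤ g0 < z`.  If `c` is isolated in `CO(G)`, then `<` is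
isolated in `LO(Ghat)`. -/
theorem isolated_circular_quotient_gives_isolated_left_order
    {Ghat : Type*} [Group Ghat] [Group.FG Ghat] (z : Ghat)
    (hz : ∀ g : Ghat, g * z = z * g) [hN : (Subgroup.zpowers z).Normal]
    (r : Ghat → Ghat → Prop) (hr : IsLeftOrder r) (h1z : r 1 z)
    (hcof : ∀ g : Ghat, ∃ n : ℕ, r g (z ^ n))
    (c : (Ghat ⧸ Subgroup.zpowers z) → (Ghat ⧸ Subgroup.zpowers z) →
      (Ghat ⧸ Subgroup.zpowers z) → ℤ)
    (hco : IsCircularOrder c)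
    (hcdef : ∀ g1 g2 g3 : Ghat,
      ((g1 = 1 ∨ r 1 g1) ∧ r g1 z) → ((g2 = 1 ∨ r 1 g2) ∧ r g2 z) →
      ((g3 = 1 ∨ r 1 g3) ∧ r g3 z) →
      c (QuotientGroup.mk g1) (QuotientGroup.mk g2) (QuotientGroup.mk g3) =
        cOfRel r g1 g2 g3) :
    IsIsolatedCO c → IsIsolatedLO r := by
  classical
  rintro ⟨SG, hSG⟩
  have hb : ∀ g, ∃ m n : ℤ, r (z ^ m) g ∧ r g (z ^ n) := by
    intro g
    obtain ⟨n, hn⟩ := hcof g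
    obtain ⟨m, hm⟩ := hcof g⁻¹
    refine ⟨-m, n, ?_, by exact_mod_cast hn⟩
    have := hr.2.2.2 (g * z ^ (-(m : ℤ))) _ _ hm
    rw [← zpow_natCast, mul_assoc, mul_assoc, ← zpow_add, ← aux_comm hz g⁻¹,
      mul_inv_cancel_left] at this
    simpa using this
  obtain ⟨ψ, hs⟩ := aux_exists_psi hr h1z hb
  choose rep hrep hrep' using exists_rep hr hz h1z hs
  have hcq : c = quotC z ψ := by
    funext u v w
    rw [← hrep u, ← hrep v, ← hrep w, quotC_mk hr hz hs,
      psiC_eq hr hz hs (hrep' u) (hrep' v) (hrep' w), hcdef _ _ _ (hrep' u) (hrep' v) (hrep' w)]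
  obtain ⟨T, hT⟩ := Group.fg_def.1 (inferInstance : Group.FG Ghat)
  refine ⟨{1, z} ∪ SG.image rep ∪ T ∪ T.image (fun g => z ^ (ψ g / 2)) ∪
    T.image (fun g => z ^ (ψ g / 2 + 1)), ?_⟩
  intro r' hr' hag
  set S := {1, z} ∪ SG.image rep ∪ T ∪ T.image (fun g => z ^ (ψ g / 2)) ∪
    T.image (fun g => z ^ (ψ g / 2 + 1)) with hS
  have m1 : (1 : Ghat) ∈ S := by simp [hS]
  have mz : z ∈ S := by simp [hS]
  have mrep : ∀ u ∈ SG, rep u ∈ S := fun u hu => by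
    simp only [hS, Finset.mem_union, Finset.mem_image]
    exact Or.inl (Or.inl (Or.inl (Or.inr ⟨u, hu, rfl⟩)))
  have mT : ∀ g ∈ T, g ∈ S := fun u hu => by
    simp only [hS, Finset.mem_union]
    exact Or.inl (Or.inl (Or.inr hu))
  have mT1 : ∀ g ∈ T, z ^ (ψ g / 2) ∈ S := fun u hu => by
    simp only [hS, Finset.mem_union, Finset.mem_image]
    exact Or.inl (Or.inr ⟨u, hu, rfl⟩)
  have mT2 : ∀ g ∈ T, z ^ (ψ g / 2 + 1) ∈ S := fun u hu => by
    simp only [hS, Finset.mem_union, Finset.mem_image]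
    exact Or.inr ⟨u, hu, rfl⟩
  have h1z' : r' 1 z := (hag _ m1 _ mz).2 h1z
  have hgen : ∀ g ∈ T, (∃ m, g = z ^ m ∧ ψ g = 2 * m) ∨
      ∃ m, ψ g = 2 * m + 1 ∧ r' (z ^ m) g ∧ r' g (z ^ (m + 1)) := by
    intro g hg
    rcases Int.even_or_odd' (ψ g) with ⟨m, h | h⟩
    · exact Or.inl ⟨m, (hs g m).1.1 h, h⟩
    · obtain ⟨a1, a2⟩ := (hs g m).2.1 h
      have e : ψ g / 2 = m := by omega
      have e1 := mT1 g hg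
      have e2 := mT2 g hg
      rw [e] at e1 e2
      exact Or.inr ⟨m, h, (hag _ e1 _ (mT g hg)).2 a1, (hag _ (mT g hg) _ e2).2 a2⟩
  have hb' : ∀ g, ∃ m n : ℤ, r' (z ^ m) g ∧ r' g (z ^ n) := by
    apply bounds_of_gen hr' hz h1z' hT
    intro g hg
    rcases hgen g hg with ⟨m, rfl, -⟩ | ⟨m, -, a1, a2⟩
    · exact ⟨m - 1, m + 1, aux_zpow_lt hr' h1z' (by omega), aux_zpow_lt hr' h1z' (by omega)⟩
    · exact ⟨_, _, a1, a2⟩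
  obtain ⟨ψ', hs'⟩ := aux_exists_psi hr' h1z' hb'
  have hrep2 : ∀ u ∈ SG, (rep u = 1 ∨ r' 1 (rep u)) ∧ r' (rep u) z := by
    intro u hu
    rw [hag _ m1 _ (mrep u hu), hag _ (mrep u hu) _ mz]
    exact hrep' u
  have hc' : quotC z ψ' = c := by
    apply hSG _ (quotC_circ hr' hz hs')
    intro u hu v hv w hw
    rw [hcq, ← hrep u, ← hrep v, ← hrep w, quotC_mk hr hz hs, quotC_mk hr' hz hs',
      psiC_eq hr hz hs (hrep' u) (hrep' v) (hrep' w),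
      psiC_eq hr' hz hs' (hrep2 u hu) (hrep2 v hv) (hrep2 w hw)]
    have a := mrep u hu
    have b := mrep v hv
    have d := mrep w hw
    simp only [cOfRel, hag _ a _ b, hag _ b _ d, hag _ d _ a]
  have hψ := psi_unique hr hr' hz hs hs' hT (fun g hg => by
    rcases hgen g hg with ⟨m, e, e'⟩ | ⟨m, e, a⟩
    · rw [e', (hs' g m).1.2 e]
    · rw [e, (hs' g m).2.2 a]) (hc'.trans hcq)
  apply order_ext hr hr'
  intro x
  rw [psi_pos hr h1z hs, psi_pos hr' h1z' hs', hψ]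

end
end
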